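/- Let (Ω, F, P) be a probability space, let L : ℝ^m → ℝ be nonnegative, differentiable and 1-smooth, let θ > 0, γ > 0, and fix ε > 0 with ε < θ. Set ε' = ε/θ, δ = (1 + 2ε'²)/(1 + 3ε'²), and η = (ε'²/4)/(1 + ε'²). Let (F_t)_{t≥1} be a filtration, w₁ ∈ ℝ^m deterministic, and (w_t)_{t≥1}, (g_t)_{t≥1} random sequences such that: w_t is F_t-measurable, g_t is F_{t+1}-measurable and integrable, E[g_t | F_t] = ∇L(w_t) almost surely, ‖g_t − ∇L(w_t)‖ ≤ θ almost surely, ‖∇L(w_t)‖ is square-integrable for each t, and w_{t+1} = w_t − h(g_t)·g_t with h(g) = η·min{1, max{δ, γ/‖g‖}} (and h(g) = η when g = 0). Then for every positive integer T with T ≥ θ⁴/ε⁴: min_{t=1,…,T} E[‖∇L(w_t)‖²] ≤ ε² + L(w₁)·(ε⁴/θ⁴)·16(1 + ε'²)²(1 + 3ε'²) / (ε'²·(3ε'⁴ + 9ε'² + 4)). -/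

import Mathlib

open MeasureTheory
open scoped RealInnerProductSpace Classical

/-- The δ-GClip step size `h(g) = η · min {1, max {δ, γ/‖g‖}}`, with the convention
that it equals `η` when `g = 0`. -/
noncomputable def deltaGClipStep {m : ℕ} (η γ δ : ℝ) (g : EuclideanSpace ℝ (Fin m)) : ℝ :=
  if g = 0 then η else η * min 1 (max δ (γ / ‖g‖))

/-- The δ-GClip step size never exceeds `η`. -/
lemma deltaGClipStep_le {m : ℕ} {η γ δ : ℝ} (hη : 0 ≤ η) (g : EuclideanSpace ℝ (Fin m)) :
    deltaGClipStep η γ δ g ≤ η := by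
  unfold deltaGClipStep
  split_ifs
  · exact le_rfl
  · exact mul_le_of_le_one_right hη (min_le_left _ _)

/-- The δ-GClip step size is at least `η δ`. -/
lemma le_deltaGClipStep {m : ℕ} {η γ δ : ℝ} (hη : 0 ≤ η) (hδ : δ ≤ 1)
    (g : EuclideanSpace ℝ (Fin m)) : η * δ ≤ deltaGClipStep η γ δ g := by
  unfold deltaGClipStep
  split_ifs
  · exact mul_le_of_le_one_right hη hδ
  · exact mul_le_mul_of_nonneg_left (le_min hδ (le_max_left _ _)) hη

lemma measurable_gradient {m : ℕ} (L : EuclideanSpace ℝ (Fin m) → ℝ) :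
    Measurable (gradient L) :=
  (InnerProductSpace.toDual ℝ (EuclideanSpace ℝ (Fin m))).symm.continuous.measurable.comp
    (measurable_fderiv ℝ L)

/-- One-step descent inequality for a step size `h ∈ [η δ, η]` and a gradient estimate `g` whose
error is at most `θ`, with the part linear in the error `g - ∇L(x)` isolated. -/
lemma descent_of_step_mem {E : Type*} [NormedAddCommGroup E] [InnerProductSpace ℝ E]
    [CompleteSpace E] {L : E → ℝ}
    (hsmooth : ∀ x y, L y ≤ L x + ⟪gradient L x, y - x⟫ + 1 / 2 * ‖y - x‖ ^ 2)
    {η δ θ h : ℝ} (hη : 0 ≤ η) (hδ0 : 0 ≤ δ) (hh : η * δ ≤ h) (hh' : h ≤ η) {x g : E}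
    (hg : ‖g - gradient L x‖ ≤ θ) :
    L (x - h • g) ≤ L x - η * (1 - 3 / 2 * (1 - δ) - η / 2) * ‖gradient L x‖ ^ 2
      + η * ((1 - δ) / 2 + η / 2) * θ ^ 2
      + (η ^ 2 - η) * ⟪gradient L x, g - gradient L x⟫ := by
  have hs := hsmooth x (x - h • g)
  rw [sub_sub_cancel_left, inner_neg_right, norm_neg, inner_smul_right, norm_smul, mul_pow,
    Real.norm_eq_abs, sq_abs] at hs
  obtain ⟨n, rfl⟩ : ∃ n, g = gradient L x + n := ⟨g - gradient L x, by abel⟩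
  set G := gradient L x
  rw [add_sub_cancel_left] at hg ⊢
  rw [inner_add_right, real_inner_self_eq_norm_sq, norm_add_sq_real] at hs
  have hin : ⟪G, n⟫ ≤ ‖G‖ * ‖n‖ := real_inner_le_norm G n
  have hn : ‖n‖ ^ 2 ≤ θ ^ 2 := pow_le_pow_left₀ (norm_nonneg n) hg 2
  have hs1 : ⟪G, n⟫ ≤ ‖G‖ ^ 2 / 2 + θ ^ 2 / 2 := by nlinarith [sq_nonneg (‖G‖ - ‖n‖)]
  have h0 : 0 ≤ h := (mul_nonneg hη hδ0).trans hh
  have hsq : h ^ 2 ≤ η ^ 2 := pow_le_pow_left₀ h0 hh' 2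
  have hN : 0 ≤ ‖G‖ ^ 2 + 2 * ⟪G, n⟫ + ‖n‖ ^ 2 := by
    rw [← norm_add_sq_real]; positivity
  have e1 := mul_le_mul_of_nonneg_right hsq hN
  have e2 : (η - h) * (‖G‖ ^ 2 + ⟪G, n⟫) ≤ (η - h) * (3 / 2 * ‖G‖ ^ 2 + θ ^ 2 / 2) :=
    mul_le_mul_of_nonneg_left (by linarith) (by linarith)
  have e3 : (η - h) * (3 / 2 * ‖G‖ ^ 2 + θ ^ 2 / 2)
      ≤ η * (1 - δ) * (3 / 2 * ‖G‖ ^ 2 + θ ^ 2 / 2) :=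
    mul_le_mul_of_nonneg_right (by linarith) (by positivity)
  have e4 := mul_le_mul_of_nonneg_left hn (sq_nonneg η)
  linarith

section Unbiased

variable {E Ω : Type*} [NormedAddCommGroup E] [InnerProductSpace ℝ E]
  {m mΩ : MeasurableSpace Ω} {P : Measure Ω} [IsProbabilityMeasure P] {G g : Ω → E} {θ : ℝ}

/-- The inner product of a square-integrable function with a function of almost surely bounded
norm is integrable. -/
lemma integrable_inner_of_norm_le (hG : AEStronglyMeasurable G P)
    (hg : AEStronglyMeasurable g P) (hsq : Integrable (fun ω => ‖G ω‖ ^ 2) P)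
    (hb : ∀ᵐ ω ∂P, ‖g ω‖ ≤ θ) : Integrable (fun ω => ⟪G ω, g ω⟫) P := by
  refine (hsq.add (integrable_const (θ ^ 2))).mono' (hG.inner hg) ?_
  filter_upwards [hb] with ω hω
  have h1 := norm_inner_le_norm (𝕜 := ℝ) (G ω) (g ω)
  have h2 := pow_le_pow_left₀ (norm_nonneg _) hω 2
  simp only [Pi.add_apply]
  nlinarith [sq_nonneg (‖G ω‖ - ‖g ω‖), sq_nonneg ‖G ω‖, sq_nonneg ‖g ω‖]

/-- An `m`-measurable function is orthogonal to any function with vanishing conditional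
expectation given `m`. -/
lemma integral_inner_eq_zero_of_condExp [CompleteSpace E] (hm : m ≤ mΩ)
    (hG : StronglyMeasurable[m] G) (hg : Integrable g P)
    (hGg : Integrable (fun ω => ⟪G ω, g ω⟫) P) (hc : P[g | m] =ᵐ[P] 0) :
    ∫ ω, ⟪G ω, g ω⟫ ∂P = 0 := by
  rw [← integral_condExp hm]
  refine integral_eq_zero_of_ae ?_
  have h : P[fun ω => ⟪G ω, g ω⟫ | m] =ᵐ[P] fun ω => ⟪G ω, P[g | m] ω⟫ :=
    condExp_bilin_of_stronglyMeasurable_left (innerSL ℝ) hG hGg hg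
  filter_upwards [h, hc] with ω h1 h2
  rw [h1, h2]
  simp

end Unbiased

/-- The decrease coefficient of the specific hyperparameters, where `x` is the square of the
ratio `ε / θ`. -/
lemma deltaGClip_decrease_coeff {x δ η : ℝ} (hx : 0 < x) (hδ : δ = (1 + 2 * x) / (1 + 3 * x))
    (hη : η = (x / 4) / (1 + x)) :
    1 - 3 / 2 * (1 - δ) - η / 2 = (8 + 19 * x + 9 * x ^ 2) / (8 * (1 + x) * (1 + 3 * x)) := by
  subst hδ hη
  field_simp
  ring

/-- The noise coefficient of the specific hyperparameters is at most `x` times the decrease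
coefficient. -/
lemma deltaGClip_noise_coeff_le {x δ η : ℝ} (hx : 0 < x) (hδ : δ = (1 + 2 * x) / (1 + 3 * x))
    (hη : η = (x / 4) / (1 + x)) :
    (1 - δ) / 2 + η / 2 ≤ x * (1 - 3 / 2 * (1 - δ) - η / 2) := by
  have h : x * (1 - 3 / 2 * (1 - δ) - η / 2) - ((1 - δ) / 2 + η / 2)
      = x * (3 + 12 * x + 9 * x ^ 2) / (8 * (1 + x) * (1 + 3 * x)) := by
    subst hδ hη
    field_simp
    ring
  have : 0 ≤ x * (3 + 12 * x + 9 * x ^ 2) / (8 * (1 + x) * (1 + 3 * x)) := by positivity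
  linarith

lemma one_le_deltaGClip_rate {x δ η : ℝ} (hx : 0 < x) (hδ : δ = (1 + 2 * x) / (1 + 3 * x))
    (hη : η = (x / 4) / (1 + x)) :
    1 ≤ η * (1 - 3 / 2 * (1 - δ) - η / 2) *
      ((16 * (1 + x) ^ 2 * (1 + 3 * x)) / (x * (3 * x ^ 2 + 9 * x + 4))) := by
  have h : η * (1 - 3 / 2 * (1 - δ) - η / 2) *
      ((16 * (1 + x) ^ 2 * (1 + 3 * x)) / (x * (3 * x ^ 2 + 9 * x + 4)))
      = (8 + 19 * x + 9 * x ^ 2) / (2 * (3 * x ^ 2 + 9 * x + 4)) := by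
    rw [deltaGClip_decrease_coeff hx hδ hη, hη]
    field_simp
    ring
  rw [h, one_le_div (by positivity)]
  nlinarith

/-- If a nonnegative sequence `a` decreases by at least `c (b t - r)` at each step, then for
some `t ≤ T` the value `b t` is at most `r + K`, as soon as `a 1 ≤ c T K`. -/
lemma exists_le_of_telescoping {a b : ℕ → ℝ} {c r K : ℝ} {T : ℕ} (hT : 0 < T) (hc : 0 < c)
    (ha : ∀ t, 1 ≤ t → 0 ≤ a t)
    (hstep : ∀ t, 1 ≤ t → a (t + 1) ≤ a t - c * (b t - r)) (hK : a 1 ≤ c * T * K) :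
    ∃ t, 1 ≤ t ∧ t ≤ T ∧ b t ≤ r + K := by
  by_contra! hcon
  have key : ∀ n, n < T → a (n + 2) < a 1 - c * (n + 1) * K := by
    intro n
    induction n with
    | zero =>
      intro h
      have h1 := hstep 1 le_rfl
      have h2 := mul_lt_mul_of_pos_left (hcon 1 le_rfl h) hc
      push_cast
      linarith
    | succ n ih =>
      intro h
      have h0 := ih (by omega)
      have h1 := hstep (n + 2) (by omega)
      have h2 := mul_lt_mul_of_pos_left (hcon (n + 2) (by omega) h) hc
      push_cast
      linarith
  obtain ⟨n, rfl⟩ : ∃ n, T = n + 1 := ⟨T - 1, by omega⟩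
  have h1 := key n (by omega)
  have h2 := ha (n + 2) (by omega)
  push_cast at hK
  linarith

/-- convergence of stochastic δ-GClip with the specific hyperparameters
`β = 1`, `δ = (1+2ε'²)/(1+3ε'²)` and `η = (ε'²/4)/(1+ε'²)` where `ε' = ε/θ`:
for every `T ≥ θ⁴/ε⁴`,
`min_{t=1..T} E[‖∇L(w_t)‖²] ≤ ε² + L(w₁)·(ε⁴/θ⁴)·16(1+ε'²)²(1+3ε'²)/(ε'²(3ε'⁴+9ε'²+4))`. -/
theorem stochastic_deltaGClip_convergence_specific {m : ℕ}
    {Ω : Type*} {mΩ : MeasurableSpace Ω} (P : Measure Ω) [IsProbabilityMeasure P]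
    (L : EuclideanSpace ℝ (Fin m) → ℝ) (θ γ ε : ℝ)
    (hθ : 0 < θ) (hγ : 0 < γ) (hε : 0 < ε) (hεθ : ε < θ)
    (hL0 : ∀ x, 0 ≤ L x) (hdiff : Differentiable ℝ L)
    (hsmooth : ∀ x y, L y ≤ L x + ⟪gradient L x, y - x⟫ + 1 / 2 * ‖y - x‖ ^ 2)
    (ε' δ η : ℝ)
    (hε' : ε' = ε / θ)
    (hδ : δ = (1 + 2 * ε' ^ 2) / (1 + 3 * ε' ^ 2))
    (hη : η = (ε' ^ 2 / 4) / (1 + ε' ^ 2))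
    (ℱ : Filtration ℕ mΩ)
    (w₁ : EuclideanSpace ℝ (Fin m))
    (w g : ℕ → Ω → EuclideanSpace ℝ (Fin m))
    (hw1 : w 1 = fun _ => w₁)
    (hwmeas : ∀ t, StronglyMeasurable[ℱ t] (w t))
    (hgmeas : ∀ t, StronglyMeasurable[ℱ (t + 1)] (g t))
    (hgint : ∀ t, Integrable (g t) P)
    (hunbiased : ∀ t, P[g t | ℱ t] =ᵐ[P] fun ω => gradient L (w t ω))
    (hnoise : ∀ t, ∀ᵐ ω ∂P, ‖g t ω - gradient L (w t ω)‖ ≤ θ)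
    (hsqint : ∀ t, Integrable (fun ω => ‖gradient L (w t ω)‖ ^ 2) P)
    (hupd : ∀ t, 1 ≤ t →
      w (t + 1) = fun ω => w t ω - deltaGClipStep η γ δ (g t ω) • g t ω) :
    ∀ T : ℕ, θ ^ 4 / ε ^ 4 ≤ (T : ℝ) → ∃ t, 1 ≤ t ∧ t ≤ T ∧
      ∫ ω, ‖gradient L (w t ω)‖ ^ 2 ∂P ≤
        ε ^ 2 + L w₁ * (ε ^ 4 / θ ^ 4) *
          (16 * (1 + ε' ^ 2) ^ 2 * (1 + 3 * ε' ^ 2)) /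
            (ε' ^ 2 * (3 * ε' ^ 4 + 9 * ε' ^ 2 + 4)) := by
  intro T hT
  have hε'0 : 0 < ε' := hε' ▸ div_pos hε hθ
  have hx : 0 < ε' ^ 2 := by positivity
  have hη0 : 0 < η := by rw [hη]; positivity
  have hδ0 : 0 ≤ δ := by rw [hδ]; positivity
  have hδ1 : δ ≤ 1 := by rw [hδ, div_le_one (by positivity)]; linarith
  set A := 1 - 3 / 2 * (1 - δ) - η / 2 with hA
  have hA0 : 0 < A := by rw [hA, deltaGClip_decrease_coeff hx hδ hη]; positivity
  have hB := deltaGClip_noise_coeff_le hx hδ hη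
  have hεeq : ε' ^ 2 * θ ^ 2 = ε ^ 2 := by rw [hε']; field_simp
  have hGm : ∀ t, StronglyMeasurable[ℱ t] (fun ω => gradient L (w t ω)) := fun t =>
    ((measurable_gradient L).comp (hwmeas t).measurable).stronglyMeasurable
  have hnint : ∀ t, Integrable (fun ω => g t ω - gradient L (w t ω)) P := fun t =>
    (hgint t).sub (integrable_condExp.congr (hunbiased t))
  have hin : ∀ t, Integrable
      (fun ω => ⟪gradient L (w t ω), g t ω - gradient L (w t ω)⟫) P := fun t =>
    integrable_inner_of_norm_le ((hGm t).mono (ℱ.le t)).aestronglyMeasurable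
      (hnint t).aestronglyMeasurable (hsqint t) (hnoise t)
  have hin0 : ∀ t, ∫ ω, ⟪gradient L (w t ω), g t ω - gradient L (w t ω)⟫ ∂P = 0 := by
    intro t
    have hGint : Integrable (fun ω => gradient L (w t ω)) P :=
      integrable_condExp.congr (hunbiased t)
    refine integral_inner_eq_zero_of_condExp (ℱ.le t) (hGm t) (hnint t) (hin t) ?_
    have h := condExp_sub (hgint t) hGint (ℱ t)
    rw [condExp_of_stronglyMeasurable (ℱ.le t) (hGm t) hGint] at h
    filter_upwards [h, hunbiased t] with ω h1 h2
    refine h1.trans ?_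
    simp [h2]
  have hdesc : ∀ t, 1 ≤ t → ∀ᵐ ω ∂P, L (w (t + 1) ω) ≤
      L (w t ω) - η * A * ‖gradient L (w t ω)‖ ^ 2
        + η * ((1 - δ) / 2 + η / 2) * θ ^ 2
        + (η ^ 2 - η) * ⟪gradient L (w t ω), g t ω - gradient L (w t ω)⟫ := by
    intro t ht
    filter_upwards [hnoise t] with ω hω
    rw [hupd t ht]
    exact descent_of_step_mem hsmooth hη0.le hδ0 (le_deltaGClipStep hη0.le hδ1 _)
      (deltaGClipStep_le hη0.le _) hω
  have hbound : ∀ t, Integrable (fun ω => L (w t ω)) P → Integrable (fun ω =>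
      L (w t ω) - η * A * ‖gradient L (w t ω)‖ ^ 2
        + η * ((1 - δ) / 2 + η / 2) * θ ^ 2
        + (η ^ 2 - η) * ⟪gradient L (w t ω), g t ω - gradient L (w t ω)⟫) P := fun t hLt =>
    ((hLt.sub ((hsqint t).const_mul _)).add (integrable_const _)).add ((hin t).const_mul _)
  have hLint : ∀ t, 1 ≤ t → Integrable (fun ω => L (w t ω)) P := by
    intro t ht
    induction t, ht using Nat.le_induction with
    | base => rw [hw1]; exact integrable_const _
    | succ t ht ih =>
      refine (hbound t ih).mono' (hdiff.continuous.comp_stronglyMeasurable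
        ((hwmeas (t + 1)).mono (ℱ.le _))).aestronglyMeasurable ?_
      filter_upwards [hdesc t ht] with ω hω
      rwa [Real.norm_of_nonneg (hL0 _)]
  have hstep : ∀ t, 1 ≤ t → ∫ ω, L (w (t + 1) ω) ∂P ≤
      ∫ ω, L (w t ω) ∂P - η * A * (∫ ω, ‖gradient L (w t ω)‖ ^ 2 ∂P - ε ^ 2) := by
    intro t ht
    have h := integral_mono_ae (hLint (t + 1) (by omega)) (hbound t (hLint t ht)) (hdesc t ht)
    have i1 : Integrable (fun ω => L (w t ω) - η * A * ‖gradient L (w t ω)‖ ^ 2) P :=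
      (hLint t ht).sub ((hsqint t).const_mul _)
    have i2 : Integrable (fun ω => L (w t ω) - η * A * ‖gradient L (w t ω)‖ ^ 2
        + η * ((1 - δ) / 2 + η / 2) * θ ^ 2) P := i1.add (integrable_const _)
    rw [integral_add i2 ((hin t).const_mul _), integral_add i1 (integrable_const _),
      integral_sub (hLint t ht) ((hsqint t).const_mul _),
      integral_const_mul, integral_const_mul, integral_const_mul, hin0 t, integral_const] at h
    simp only [probReal_univ, one_smul, mul_zero, add_zero] at h
    have hB' : η * ((1 - δ) / 2 + η / 2) * θ ^ 2 ≤ η * A * ε ^ 2 := by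
      rw [← hεeq]
      calc η * ((1 - δ) / 2 + η / 2) * θ ^ 2 ≤ η * (ε' ^ 2 * A) * θ ^ 2 := by gcongr
        _ = η * A * (ε' ^ 2 * θ ^ 2) := by ring
    linarith
  have hT0 : (0 : ℝ) < T := lt_of_lt_of_le (by positivity) hT
  have hTε : 1 ≤ T * (ε ^ 4 / θ ^ 4) := by
    rw [div_le_iff₀ (by positivity)] at hT
    rwa [← mul_div_assoc, one_le_div (by positivity)]
  have hC := one_le_deltaGClip_rate hx hδ hη
  rw [← hA, ← pow_mul] at hC
  refine exists_le_of_telescoping (a := fun t => ∫ ω, L (w t ω) ∂P) (c := η * A)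
    (Nat.cast_pos.mp hT0) (mul_pos hη0 hA0) (fun t _ => integral_nonneg fun ω => hL0 _) hstep ?_
  simp only [hw1, integral_const, probReal_univ, one_smul]
  have hCT := one_le_mul_of_one_le_of_one_le hTε hC
  calc L w₁ ≤ L w₁ * _ := le_mul_of_one_le_right (hL0 _) hCT
    _ = _ := by ring
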